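/- Let E_avg ≥ 0, E_max ≥ 0, V ≥ 0, θ > 0, and C be real constants, let E : ℕ → ℝ satisfy 0 ≤ E(t) ≤ E_max for all t, let Q : ℕ → ℝ satisfy Q(0) ≥ 0 and Q(t+1) = max(Q(t) − E_avg, 0) + E(t), and let L : ℕ → ℝ be a latency sequence. Fix a frame length T ≥ 1 and a frame index k. Suppose the service placement policy used in frame k has θ-slack and latency at most C, i.e., E(τ) ≤ E_avg − θ and L(τ) ≤ C for all kT ≤ τ ≤ kT+T−1. Then the T-slot drift-plus-penalty over frame k satisfies (1/2)·Q(kT+T)² − (1/2)·Q(kT)² + V·∑_{τ=kT}^{kT+T−1} L(τ) ≤ B·T + V·T·C − θ·∑_{τ=kT}^{kT+T−1} Q(τ), where B = (E_avg² + E_max²)/2. -/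

import Mathlib

/-- **drift-plus-penalty bound under a θ-slack policy.** If the
policy used in frame `k` has `θ`-slack (`E(τ) ≤ E_avg − θ`) and latency at most
`C` on the frame, then the `T`-slot drift-plus-penalty satisfies
`(1/2)·Q(kT+T)² − (1/2)·Q(kT)² + V·∑ L(τ) ≤ B·T + V·T·C − θ·∑ Q(τ)` with
`B = (E_avg² + E_max²)/2`. -/
theorem drift_plus_penalty_bound_slack_policy
    (Eavg Emax V θ C : ℝ) (hEavg : 0 ≤ Eavg) (hEmax : 0 ≤ Emax)
    (hV : 0 ≤ V) (hθ : 0 < θ)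
    (E Q L : ℕ → ℝ)
    (hE : ∀ t, 0 ≤ E t ∧ E t ≤ Emax)
    (hQ0 : 0 ≤ Q 0)
    (hQ : ∀ t, Q (t + 1) = max (Q t - Eavg) 0 + E t)
    (T : ℕ) (hT : 1 ≤ T) (k : ℕ)
    (hslack : ∀ τ, k * T ≤ τ → τ ≤ k * T + T - 1 → E τ ≤ Eavg - θ)
    (hlat : ∀ τ, k * T ≤ τ → τ ≤ k * T + T - 1 → L τ ≤ C) :
    (1 / 2) * (Q (k * T + T)) ^ 2 - (1 / 2) * (Q (k * T)) ^ 2 +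
        V * ∑ τ ∈ Finset.Ico (k * T) (k * T + T), L τ ≤
      (Eavg ^ 2 + Emax ^ 2) / 2 * (T : ℝ) + V * (T : ℝ) * C -
        θ * ∑ τ ∈ Finset.Ico (k * T) (k * T + T), Q τ := by
  have hQn : ∀ t, 0 ≤ Q t := by
    intro t
    cases t with
    | zero => exact hQ0
    | succ n =>
      rw [hQ]
      exact add_nonneg (le_max_right _ _) (hE n).1
  have hstep : ∀ τ, k * T ≤ τ → τ ≤ k * T + T - 1 →
      (1 / 2) * (Q (τ + 1)) ^ 2 - (1 / 2) * (Q τ) ^ 2 + V * L τ ≤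
        (Eavg ^ 2 + Emax ^ 2) / 2 + V * C - θ * Q τ := by
    intro τ h1 h2
    have hs := hslack τ h1 h2
    have hl := mul_le_mul_of_nonneg_left (hlat τ h1 h2) hV
    obtain ⟨ha, hb⟩ := hE τ
    have hq := hQn τ
    have hm1 : max (Q τ - Eavg) 0 ≤ Q τ := max_le (by linarith) hq
    have hm2 : (max (Q τ - Eavg) 0) ^ 2 ≤ (Q τ - Eavg) ^ 2 := by
      rcases max_cases (Q τ - Eavg) 0 with h | h
      · rw [h.1]
      · rw [h.1]
        nlinarith [sq_nonneg (Q τ - Eavg)]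
    have hsq : E τ ^ 2 ≤ Emax ^ 2 := pow_le_pow_left₀ ha hb 2
    have h3 := mul_le_mul_of_nonneg_left hm1 ha
    have h4 := mul_le_mul_of_nonneg_left hs hq
    rw [hQ]
    nlinarith
  have key : ∀ n, n ≤ T →
      (1 / 2) * (Q (k * T + n)) ^ 2 - (1 / 2) * (Q (k * T)) ^ 2 +
        V * ∑ τ ∈ Finset.Ico (k * T) (k * T + n), L τ ≤
      (Eavg ^ 2 + Emax ^ 2) / 2 * (n : ℝ) + V * (n : ℝ) * C -
        θ * ∑ τ ∈ Finset.Ico (k * T) (k * T + n), Q τ := by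
    intro n
    induction n with
    | zero => intro _; simp
    | succ n ih =>
      intro hn
      have h1 := ih (by omega)
      have h2 := hstep (k * T + n) (by omega) (by omega)
      rw [← add_assoc, Finset.sum_Ico_succ_top (by omega), Finset.sum_Ico_succ_top (by omega)]
      push_cast
      linarith
  exact key T le_rfl
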